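/- Let k ≥ 1 and p₁ > k, p₂ > k, let G = K_{p₁} ∘_k K_{p₂}, and let L be the Laplacian matrix of G. Then for every vertex i ∈ A, every vertex j ∈ B, and every matrix X with L·X·L = L, one has X_{ii} + X_{jj} − X_{ij} − X_{ji} = (p₁ + p₂)(k+1)/(k·p₁·p₂); that is, the resistance distance between a non-identified vertex of K_{p₁} and a non-identified vertex of K_{p₂} equals (p₁+p₂)(k+1)/(k p₁ p₂). -/

import Mathlib

open Matrix BigOperators

-- The Laplacian matrix `L = D − A` of a finite simple graph, over `ℝ`.
open Classical in
noncomputable def lapMat {V : Type} [Fintype V] (G : SimpleGraph V) : Matrix V V ℝ :=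
  Matrix.of fun i j =>
    if i = j then (Nat.card {v // G.Adj i v} : ℝ)
    else if G.Adj i j then -1 else 0

/-- Vertex set of the `k`-coalescence `K_{p₁} ∘ₖ K_{p₂}`: the identified clique `T`
(of size `k`), the remaining vertices `A` of `K_{p₁}` (size `a = p₁ − k`) and the
remaining vertices `B` of `K_{p₂}` (size `b = p₂ − k`). -/
abbrev CoalV (k a b : ℕ) := Fin k ⊕ (Fin a ⊕ Fin b)

/-- `u` lies in the part `A`. -/
def memA {k a b : ℕ} : CoalV k a b → Prop
  | Sum.inr (Sum.inl _) => True
  | _ => False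

/-- `u` lies in the part `B`. -/
def memB {k a b : ℕ} : CoalV k a b → Prop
  | Sum.inr (Sum.inr _) => True
  | _ => False

/-- The `k`-coalescence `K_{p₁} ∘ₖ K_{p₂}` (with `a = p₁ − k`, `b = p₂ − k`):
two distinct vertices are adjacent iff they do not lie one in `A` and one in `B`. -/
def KCoal (k a b : ℕ) : SimpleGraph (CoalV k a b) :=
  SimpleGraph.fromRel (fun u v => ¬((memA u ∧ memB v) ∨ (memB u ∧ memA v)))

lemma lapMat_transpose {V : Type} [Fintype V] (G : SimpleGraph V) :
    (lapMat G)ᵀ = lapMat G := by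
  ext u v
  by_cases h : u = v
  · subst h; rfl
  · by_cases h' : G.Adj u v
    · simp [lapMat, h, Ne.symm h, h', h'.symm]
    · simp [lapMat, h, Ne.symm h, h', mt SimpleGraph.Adj.symm h']

open Classical in
lemma lapMat_mulVec_apply {V : Type} [Fintype V] (G : SimpleGraph V) (y : V → ℝ) (u : V) :
    (lapMat G *ᵥ y) u = ∑ v, if G.Adj u v then y u - y v else 0 := by
  have hcard : (Nat.card {v // G.Adj u v} : ℝ) = ∑ v, if G.Adj u v then (1 : ℝ) else 0 := by
    simp [Nat.card_eq_fintype_card, Fintype.card_subtype]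
  have hterm : ∀ v, lapMat G u v * y v
      = (if u = v then (Nat.card {w // G.Adj u w} : ℝ) * y u else 0)
        - if G.Adj u v then y v else 0 := by
    intro v
    by_cases h : u = v
    · subst h; simp [lapMat]
    · by_cases h' : G.Adj u v <;> simp [lapMat, h, h']
  simp only [mulVec, dotProduct, hterm, Finset.sum_sub_distrib, Finset.sum_ite_eq,
    Finset.mem_univ, if_true, hcard, Finset.sum_mul]
  rw [← Finset.sum_sub_distrib]
  refine Finset.sum_congr rfl fun v _ => ?_
  split_ifs <;> simp

/-- If `y` is a potential whose current is a unit flow from `u` to `v`, then any `{1}`-inverse of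
the Laplacian computes the potential difference of `y` between `u` and `v`. -/
lemma resistance_eq_of_potential {V : Type} [Fintype V] [DecidableEq V] (G : SimpleGraph V)
    (X : Matrix V V ℝ) (hX : lapMat G * X * lapMat G = lapMat G) (u v : V) (y : V → ℝ)
    (hy : lapMat G *ᵥ y = Pi.single u 1 - Pi.single v 1) :
    X u u + X v v - X u v - X v u = y u - y v := by
  have hy' : y ᵥ* lapMat G = Pi.single u 1 - Pi.single v 1 := by
    rw [← mulVec_transpose, lapMat_transpose, hy]
  have h : y ⬝ᵥ ((lapMat G * X * lapMat G) *ᵥ y) = y ⬝ᵥ (lapMat G *ᵥ y) := by rw [hX]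
  rw [← mulVec_mulVec, ← mulVec_mulVec, dotProduct_mulVec y, hy', hy] at h
  simp [mulVec_sub, sub_dotProduct, dotProduct_sub] at h
  linarith

/-- The potential on `KCoal k a b` driving a unit current from the vertex `i` of `A` to the
vertex `j` of `B`, normalised to vanish on `T`. -/
noncomputable def coalPotential {k a b : ℕ} (i : Fin a) (j : Fin b) : CoalV k a b → ℝ
  | Sum.inl _ => 0
  | Sum.inr (Sum.inl x) => ((if x = i then 1 else 0) + 1 / (k : ℝ)) / (k + a)
  | Sum.inr (Sum.inr x) => -((if x = j then 1 else 0) + 1 / (k : ℝ)) / (k + b)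

lemma lapMat_mulVec_coalPotential {k a b : ℕ} (hk : 1 ≤ k) (i : Fin a) (j : Fin b) :
    lapMat (KCoal k a b) *ᵥ coalPotential i j
      = Pi.single (Sum.inr (Sum.inl i)) 1 - Pi.single (Sum.inr (Sum.inr j)) 1 := by
  classical
  have hk0 : (0 : ℝ) < k := by exact_mod_cast hk
  have ha : (k + a : ℝ) ≠ 0 := by positivity
  have hb : (k + b : ℝ) ≠ 0 := by positivity
  have hdrop : ∀ u, (∑ v, if (KCoal k a b).Adj u v then
        coalPotential i j u - coalPotential i j v else 0)
      = ∑ v : CoalV k a b, if (memA u ∧ memB v) ∨ (memB u ∧ memA v) then 0 else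
        coalPotential i j u - coalPotential i j v := by
    intro u
    refine Finset.sum_congr rfl fun v _ => ?_
    have hadj : (KCoal k a b).Adj u v ↔
        u ≠ v ∧ ¬((memA u ∧ memB v) ∨ (memB u ∧ memA v)) := by
      simp only [KCoal, SimpleGraph.fromRel_adj]
      tauto
    by_cases h : u = v
    · subst h; simp
    · simp only [hadj, ne_eq, h, not_false_eq_true, true_and, ite_not]
  ext u
  rw [lapMat_mulVec_apply, hdrop]
  rcases u with t | x | x
  · simp [memA, memB, coalPotential, Fintype.sum_sum_type, ← Finset.sum_div,
      Finset.sum_add_distrib]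
    field_simp
    ring
  · simp [memA, memB, coalPotential, Fintype.sum_sum_type, ← Finset.sum_div,
      Finset.sum_add_distrib, Pi.single_apply]
    field_simp
    split_ifs <;> ring
  · simp [memA, memB, coalPotential, Fintype.sum_sum_type, ← Finset.sum_div,
      Finset.sum_add_distrib, Pi.single_apply]
    field_simp
    split_ifs <;> ring

/-- In `K_{p₁} ∘ₖ K_{p₂}` with `k ≥ 1` and `p₁, p₂ > k`, the resistance distance between
a non-identified vertex of `K_{p₁}` and a non-identified vertex of `K_{p₂}` equals
`(p₁+p₂)(k+1)/(k·p₁·p₂)`. -/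
theorem resistance_coal_AB (k p₁ p₂ : ℕ) (hk : 1 ≤ k) (h1 : k < p₁) (h2 : k < p₂)
    (i : Fin (p₁ - k)) (j : Fin (p₂ - k))
    (X : Matrix (CoalV k (p₁ - k) (p₂ - k)) (CoalV k (p₁ - k) (p₂ - k)) ℝ)
    (hX : lapMat (KCoal k (p₁ - k) (p₂ - k)) * X * lapMat (KCoal k (p₁ - k) (p₂ - k))
        = lapMat (KCoal k (p₁ - k) (p₂ - k))) :
    X (Sum.inr (Sum.inl i)) (Sum.inr (Sum.inl i))
      + X (Sum.inr (Sum.inr j)) (Sum.inr (Sum.inr j))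
      - X (Sum.inr (Sum.inl i)) (Sum.inr (Sum.inr j))
      - X (Sum.inr (Sum.inr j)) (Sum.inr (Sum.inl i))
      = ((p₁ : ℝ) + (p₂ : ℝ)) * ((k : ℝ) + 1) / ((k : ℝ) * (p₁ : ℝ) * (p₂ : ℝ)) := by
  have hk0 : (k : ℝ) ≠ 0 := by exact_mod_cast (by omega : k ≠ 0)
  have hp₁ : (p₁ : ℝ) ≠ 0 := by exact_mod_cast (by omega : p₁ ≠ 0)
  have hp₂ : (p₂ : ℝ) ≠ 0 := by exact_mod_cast (by omega : p₂ ≠ 0)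
  rw [resistance_eq_of_potential _ X hX _ _ _ (lapMat_mulVec_coalPotential hk i j)]
  simp only [coalPotential, if_true, Nat.cast_sub h1.le, Nat.cast_sub h2.le,
    add_sub_cancel]
  field_simp
  ring
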